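/- arXiv:1712.00395 — 2 statements merged into one kernel-verified Lean document; each statement's English description precedes it below -/
import Mathlib

section
/- Assume d·θ² ≤ 1, and define U_j = log[1 + (θ/π1)(Y_j − π1)] and V_j = log[1 − (θ/π2)(Y_j − π1)]. There exist positive constants C = C(π) and D = D(π) such that whenever d > D, for all n and all 1 ≤ j ≤ d: |d·E[U_j] − (dθ²/(2π1))·x_n| ≤ C·d^{−1/2}; |d·E[V_j] + ((1+π2)/(2π2²))·dθ²·x_n| ≤ C·d^{−1/2}; |d·Var(U_j) − (dθ²/π1)·x_n| ≤ C·d^{−1/2}; |d·Var(V_j) − (π1/π2²)·dθ²·x_n| ≤ C·d^{−1/2}; and |d·Cov(U_j, V_j) + (dθ²/π2)·x_n| ≤ C·d^{−1/2}. -/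
open Finset Filter

namespace AsymIsing

/-- Level-`k` vertices of the rooted `d`-ary tree: paths of length `k` from the root. -/
abbrev Vert (d k : ℕ) : Type := Fin k → Fin d

/-- A spin configuration on levels `0, …, n` of the `d`-ary tree. -/
abbrev Conf (d n : ℕ) : Type := ∀ k : Fin (n + 1), Vert d k → Fin 2

/-- A spin configuration on level `n` only. -/
abbrev LConf (d n : ℕ) : Type := Vert d n → Fin 2

/-- The transition matrix of the asymmetric binary channel; the paper's state `1`
corresponds to the index `0` and the state `2` to the index `1`. -/
noncomputable def Mmat (θ Δ : ℝ) : Fin 2 → Fin 2 → ℝ := fun i j =>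
  if i = 0 then (if j = 0 then (1 + θ - Δ) / 2 else (1 - θ + Δ) / 2)
  else (if j = 0 then (1 - θ - Δ) / 2 else (1 + θ + Δ) / 2)

/-- The stationary distribution `π = (π₁, π₂)` of the channel. -/
noncomputable def pst (θ Δ : ℝ) : Fin 2 → ℝ := fun i =>
  if i = 0 then 1 / 2 - Δ / (2 * (1 - θ)) else 1 / 2 + Δ / (2 * (1 - θ))

/-- The root spin of a configuration. -/
def root {d n : ℕ} (σ : Conf d n) : Fin 2 := σ ⟨0, n.succ_pos⟩ (fun i => i.elim0)

/-- The restriction of a configuration to the last (`n`-th) level. -/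
def top {d n : ℕ} (σ : Conf d n) : LConf d n := σ (Fin.last n)

/-- The probability of a full configuration on levels `0, …, n` under the broadcast
process: the root is drawn from `π` and spins propagate along edges via `M`. -/
noncomputable def confProb (d : ℕ) (θ Δ : ℝ) (n : ℕ) (σ : Conf d n) : ℝ :=
  pst θ Δ (root σ) *
    ∏ k : Fin n, ∏ v : Vert d (k + 1),
      Mmat θ Δ (σ k.castSucc (v ∘ Fin.castSucc)) (σ k.succ v)

/-- `P(σ(n) = A)`: the marginal law of the level-`n` spins. -/
noncomputable def levelProb (d : ℕ) (θ Δ : ℝ) (n : ℕ) (A : LConf d n) : ℝ :=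
  ∑ σ : Conf d n, if top σ = A then confProb d θ Δ n σ else 0

/-- `P(σ_ρ = i, σ(n) = A)`. -/
noncomputable def jointProb (d : ℕ) (θ Δ : ℝ) (n : ℕ) (i : Fin 2) (A : LConf d n) : ℝ :=
  ∑ σ : Conf d n, if root σ = i ∧ top σ = A then confProb d θ Δ n σ else 0

/-- The posterior `f_n(i, A) = P(σ_ρ = i ∣ σ(n) = A)`. -/
noncomputable def post (d : ℕ) (θ Δ : ℝ) (n : ℕ) (i : Fin 2) (A : LConf d n) : ℝ :=
  jointProb d θ Δ n i A / levelProb d θ Δ n A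

/-- The law of `σ^i(n)`, i.e. `P(σ(n) = A ∣ σ_ρ = i)`. -/
noncomputable def condLevel (d : ℕ) (θ Δ : ℝ) (n : ℕ) (i : Fin 2) (A : LConf d n) : ℝ :=
  jointProb d θ Δ n i A / pst θ Δ i

/-- The total variation distance between `σ^1(n)` and `σ^2(n)`. -/
noncomputable def tvDist (d : ℕ) (θ Δ : ℝ) (n : ℕ) : ℝ :=
  (1 / 2) * ∑ A : LConf d n, |condLevel d θ Δ n 0 A - condLevel d θ Δ n 1 A|

/-- The reconstruction problem is solvable if `limsup_n d_TV(σ^1(n), σ^2(n)) > 0`. -/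
def solvable (d : ℕ) (θ Δ : ℝ) : Prop :=
  0 < Filter.limsup (fun n => tvDist d θ Δ n) Filter.atTop

/-- Non-reconstruction: `limsup_n d_TV(σ^1(n), σ^2(n)) = 0`. -/
def nonReconstruction (d : ℕ) (θ Δ : ℝ) : Prop :=
  Filter.limsup (fun n => tvDist d θ Δ n) Filter.atTop = 0

/-- Expectation of a function of the level-`n` configuration, conditioned on `σ_ρ = 1`. -/
noncomputable def expect1 (d : ℕ) (θ Δ : ℝ) (n : ℕ) (g : LConf d n → ℝ) : ℝ :=
  ∑ A : LConf d n, condLevel d θ Δ n 0 A * g A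

/-- `x_n = E f_n(1, σ^1(n)) − π₁`. -/
noncomputable def xseq (d : ℕ) (θ Δ : ℝ) (n : ℕ) : ℝ :=
  expect1 d θ Δ n (fun A => post d θ Δ n 0 A) - pst θ Δ 0

/-- `z_n = E (f_n(1, σ^1(n)) − π₁)²`. -/
noncomputable def zseq (d : ℕ) (θ Δ : ℝ) (n : ℕ) : ℝ :=
  expect1 d θ Δ n (fun A => (post d θ Δ n 0 A - pst θ Δ 0) ^ 2)

/-- The restriction of a level-`(n+1)` configuration to the subtree of the `j`-th
child of the root (paths starting with `j`). -/
def restrictChild {d n : ℕ} (j : Fin d) (A : LConf d (n + 1)) : LConf d n :=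
  fun w => A (Fin.cons j w)

/-- `Y_j = f_n(1, σ_j(n+1))`, as a function of the level-`(n+1)` configuration. -/
noncomputable def Yfun (d : ℕ) (θ Δ : ℝ) (n : ℕ) (j : Fin d) (A : LConf d (n + 1)) : ℝ :=
  post d θ Δ n 0 (restrictChild j A)

/-- `Z₁ = ∏_j (1 + (θ/π₁)(Y_j − π₁))`, as a function of the level-`(n+1)` configuration. -/
noncomputable def Z1fun (d : ℕ) (θ Δ : ℝ) (n : ℕ) (A : LConf d (n + 1)) : ℝ :=
  ∏ j : Fin d, (1 + (θ / pst θ Δ 0) * (Yfun d θ Δ n j A - pst θ Δ 0))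

/-- `Z₂ = ∏_j (1 − (θ/π₂)(Y_j − π₁))`, as a function of the level-`(n+1)` configuration. -/
noncomputable def Z2fun (d : ℕ) (θ Δ : ℝ) (n : ℕ) (A : LConf d (n + 1)) : ℝ :=
  ∏ j : Fin d, (1 - (θ / pst θ Δ 1) * (Yfun d θ Δ n j A - pst θ Δ 0))

/-- The value of `Δ` making `π = (π₁, π₂)` the stationary distribution of the channel
with second eigenvalue `θ`, namely `Δ = (1 − θ)(π₂ − π₁)`. -/
noncomputable def Dlt (θ π1 π2 : ℝ) : ℝ := (1 - θ) * (π2 - π1)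

/-- The Gaussian-approximation function
`f(s) = E[π₁ e^{sμ₁+√s W₁} / (π₁ e^{sμ₁+√s W₁} + π₂ e^{sμ₂+√s W₂})] − π₁`,
where `μ₁ = 1/(2π₁)`, `μ₂ = −(1+π₂)/(2π₂²)`, `W₁ ∼ N(0, 1/π₁)` (realized as `w/√π₁`
for `w` standard Gaussian) and `W₂ = −(π₁/π₂)·W₁`. -/
noncomputable def gfun (π1 π2 : ℝ) (s : ℝ) : ℝ :=
  (∫ w : ℝ,
      (π1 * Real.exp (s * (1 / (2 * π1)) + Real.sqrt s * (w / Real.sqrt π1))) /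
        (π1 * Real.exp (s * (1 / (2 * π1)) + Real.sqrt s * (w / Real.sqrt π1)) +
          π2 * Real.exp (s * (-(1 + π2) / (2 * π2 ^ 2)) +
            Real.sqrt s * (-(π1 / π2) * (w / Real.sqrt π1))))
    ∂(ProbabilityTheory.gaussianReal 0 1)) - π1

/-- `U_j = log(1 + (θ/π₁)(Y_j − π₁))`, as a function of the level-`(n+1)` configuration. -/
noncomputable def Ufun (d : ℕ) (θ Δ : ℝ) (n : ℕ) (j : Fin d) (A : LConf d (n + 1)) : ℝ :=
  Real.log (1 + (θ / pst θ Δ 0) * (Yfun d θ Δ n j A - pst θ Δ 0))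

/-- `V_j = log(1 − (θ/π₂)(Y_j − π₁))`, as a function of the level-`(n+1)` configuration. -/
noncomputable def Vfun (d : ℕ) (θ Δ : ℝ) (n : ℕ) (j : Fin d) (A : LConf d (n + 1)) : ℝ :=
  Real.log (1 - (θ / pst θ Δ 1) * (Yfun d θ Δ n j A - pst θ Δ 0))

/-- `E U_j` under the conditioning `σ_ρ = 1`. -/
noncomputable def EU (d : ℕ) (θ Δ : ℝ) (n : ℕ) (j : Fin d) : ℝ :=
  expect1 d θ Δ (n + 1) (Ufun d θ Δ n j)

/-- `E V_j` under the conditioning `σ_ρ = 1`. -/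
noncomputable def EV (d : ℕ) (θ Δ : ℝ) (n : ℕ) (j : Fin d) : ℝ :=
  expect1 d θ Δ (n + 1) (Vfun d θ Δ n j)

/-- `Var U_j` under the conditioning `σ_ρ = 1`. -/
noncomputable def varU (d : ℕ) (θ Δ : ℝ) (n : ℕ) (j : Fin d) : ℝ :=
  expect1 d θ Δ (n + 1) (fun A => Ufun d θ Δ n j A ^ 2) - EU d θ Δ n j ^ 2

/-- `Var V_j` under the conditioning `σ_ρ = 1`. -/
noncomputable def varV (d : ℕ) (θ Δ : ℝ) (n : ℕ) (j : Fin d) : ℝ :=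
  expect1 d θ Δ (n + 1) (fun A => Vfun d θ Δ n j A ^ 2) - EV d θ Δ n j ^ 2

/-- `Cov(U_j, V_j)` under the conditioning `σ_ρ = 1`. -/
noncomputable def covUV (d : ℕ) (θ Δ : ℝ) (n : ℕ) (j : Fin d) : ℝ :=
  expect1 d θ Δ (n + 1) (fun A => Ufun d θ Δ n j A * Vfun d θ Δ n j A) -
    EU d θ Δ n j * EV d θ Δ n j

section Moments

variable {ι : Type*} [Fintype ι] {w : ι → ℝ}

lemma abs_weighted_sum_sub_le (hw : ∀ i, 0 ≤ w i) (hw1 : ∑ i, w i = 1) {f g : ι → ℝ} {c : ℝ}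
    (h : ∀ i, |f i - g i| ≤ c) : |∑ i, w i * f i - ∑ i, w i * g i| ≤ c := by
  rw [← Finset.sum_sub_distrib]
  calc |∑ i, (w i * f i - w i * g i)| ≤ ∑ i, |w i * f i - w i * g i| :=
        Finset.abs_sum_le_sum_abs _ _
    _ ≤ ∑ i, w i * c := by
        refine Finset.sum_le_sum fun i _ => ?_
        rw [← mul_sub, abs_mul, abs_of_nonneg (hw i)]
        exact mul_le_mul_of_nonneg_left (h i) (hw i)
    _ = c := by rw [← Finset.sum_mul, hw1, one_mul]

lemma abs_weighted_sum_le (hw : ∀ i, 0 ≤ w i) (hw1 : ∑ i, w i = 1) {f : ι → ℝ} {c : ℝ}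
    (h : ∀ i, |f i| ≤ c) : |∑ i, w i * f i| ≤ c := by
  simpa using abs_weighted_sum_sub_le hw hw1 (f := f) (g := fun _ => 0) (by simpa using h)

lemma abs_log_one_add_le {t : ℝ} (ht : |t| ≤ 1 / 2) : |Real.log (1 + t)| ≤ 2 * |t| := by
  have h := Real.abs_log_sub_add_sum_range_le (x := -t) (by rw [abs_neg]; linarith) 0
  simp only [Finset.range_zero, Finset.sum_empty, abs_neg, sub_neg_eq_add, zero_add, pow_one] at h
  refine h.trans ?_
  rw [div_le_iff₀ (by linarith)]
  nlinarith [abs_nonneg t]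

lemma abs_log_one_add_sub_le {t : ℝ} (ht : |t| ≤ 1 / 2) :
    |Real.log (1 + t) - t| ≤ 2 * |t| ^ 2 := by
  have h := Real.abs_log_sub_add_sum_range_le (x := -t) (by rw [abs_neg]; linarith) 1
  simp only [Finset.sum_range_one, abs_neg, sub_neg_eq_add] at h
  have e : Real.log (1 + t) - t = (-t) ^ (0 + 1) / ((0 : ℕ) + 1) + Real.log (1 + t) := by
    push_cast; ring
  rw [e]
  refine h.trans ?_
  rw [div_le_iff₀ (by linarith)]
  change |t| ^ 2 ≤ _
  nlinarith [mul_nonneg (pow_nonneg (abs_nonneg t) 2) (sub_nonneg.2 ht)]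

lemma abs_log_one_add_sub_sub_le {t : ℝ} (ht : |t| ≤ 1 / 2) :
    |Real.log (1 + t) - (t - t ^ 2 / 2)| ≤ 2 * |t| ^ 3 := by
  have h := Real.abs_log_sub_add_sum_range_le (x := -t) (by rw [abs_neg]; linarith) 2
  simp only [Finset.sum_range_succ, Finset.sum_range_zero, abs_neg, sub_neg_eq_add] at h
  have e : Real.log (1 + t) - (t - t ^ 2 / 2) = 0 + (-t) ^ (0 + 1) / ((0 : ℕ) + 1)
      + (-t) ^ (1 + 1) / ((1 : ℕ) + 1) + Real.log (1 + t) := by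
    push_cast; ring
  rw [e]
  refine h.trans ?_
  rw [div_le_iff₀ (by linarith)]
  change |t| ^ 3 ≤ _
  nlinarith [mul_nonneg (pow_nonneg (abs_nonneg t) 3) (sub_nonneg.2 ht)]

lemma abs_mul_le_of_abs_le_one {s t c : ℝ} (hs : |s| ≤ c) (ht : |t| ≤ 1) : |s * t| ≤ c := by
  rw [abs_mul]
  exact (mul_le_of_le_one_right (abs_nonneg s) ht).trans hs

variable {W : ι → ℝ} {a b θ x y K : ℝ}

/-- Second order expansion of the mean of `log (1 + a W)`. -/
lemma abs_mean_log_sub_le (hw : ∀ i, 0 ≤ w i) (hw1 : ∑ i, w i = 1) (hW : ∀ i, |W i| ≤ 1)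
    (hK : 1 ≤ K) (hKθ : K * |θ| ≤ 1 / 2) (ha : |a| ≤ K * |θ|)
    (h1 : ∑ i, w i * W i = θ * x) (h2 : |∑ i, w i * W i ^ 2 - y| ≤ |θ|) :
    |∑ i, w i * Real.log (1 + a * W i) - (a * θ * x - a ^ 2 / 2 * y)| ≤ 3 * K ^ 3 * |θ| ^ 3 := by
  have hθ := abs_nonneg θ
  have haW := fun i => abs_mul_le_of_abs_le_one ha (hW i)
  have A := abs_weighted_sum_sub_le hw hw1 (f := fun i => Real.log (1 + a * W i))
    (g := fun i => a * W i - (a * W i) ^ 2 / 2) (c := 2 * (K * |θ|) ^ 3) fun i =>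
      (abs_log_one_add_sub_sub_le ((haW i).trans hKθ)).trans (by gcongr; exact haW i)
  have e : ∑ i, w i * (a * W i - (a * W i) ^ 2 / 2)
      = a * (θ * x) - a ^ 2 / 2 * ∑ i, w i * W i ^ 2 := by
    rw [← h1, Finset.mul_sum, Finset.mul_sum, ← Finset.sum_sub_distrib]
    exact Finset.sum_congr rfl fun i _ => by ring
  rw [e] at A
  have B : |a ^ 2 / 2 * (∑ i, w i * W i ^ 2 - y)| ≤ (K * |θ|) ^ 2 / 2 * |θ| := by
    rw [abs_mul, abs_of_nonneg (by positivity : 0 ≤ a ^ 2 / 2), ← sq_abs a]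
    gcongr
  have hK3 : K ^ 2 * |θ| ^ 3 ≤ K ^ 3 * |θ| ^ 3 := by
    gcongr
    norm_num
  have hp : 0 ≤ K ^ 3 * |θ| ^ 3 := by positivity
  rw [abs_le] at A B ⊢
  constructor <;> nlinarith

lemma abs_mean_log_le (hw : ∀ i, 0 ≤ w i) (hw1 : ∑ i, w i = 1) (hW : ∀ i, |W i| ≤ 1)
    (hK : 1 ≤ K) (hKθ : K * |θ| ≤ 1 / 2) (ha : |a| ≤ K * |θ|) (hx : |x| ≤ 1)
    (h1 : ∑ i, w i * W i = θ * x) :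
    |∑ i, w i * Real.log (1 + a * W i)| ≤ 3 * K ^ 2 * |θ| ^ 2 := by
  have hθ := abs_nonneg θ
  have haW := fun i => abs_mul_le_of_abs_le_one ha (hW i)
  have A := abs_weighted_sum_sub_le hw hw1 (f := fun i => Real.log (1 + a * W i))
    (g := fun i => a * W i) (c := 2 * (K * |θ|) ^ 2) fun i =>
      (abs_log_one_add_sub_le ((haW i).trans hKθ)).trans (by gcongr; exact haW i)
  have e : ∑ i, w i * (a * W i) = a * (θ * x) := by
    rw [← h1, Finset.mul_sum]
    exact Finset.sum_congr rfl fun i _ => by ring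
  rw [e] at A
  have B : |a * (θ * x)| ≤ K * |θ| * (|θ| * 1) := by
    rw [abs_mul, abs_mul]
    gcongr
  have hK2 : K * |θ| ^ 2 ≤ K ^ 2 * |θ| ^ 2 := by
    gcongr
    nlinarith
  rw [abs_le] at A B ⊢
  constructor <;> nlinarith

/-- Second order expansion of the covariance of `log (1 + a W)` and `log (1 + b W)`. -/
lemma abs_cov_log_sub_le (hw : ∀ i, 0 ≤ w i) (hw1 : ∑ i, w i = 1) (hW : ∀ i, |W i| ≤ 1)
    (hK : 1 ≤ K) (hKθ : K * |θ| ≤ 1 / 2) (ha : |a| ≤ K * |θ|) (hb : |b| ≤ K * |θ|)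
    (hx : |x| ≤ 1)
    (h1 : ∑ i, w i * W i = θ * x) (h2 : |∑ i, w i * W i ^ 2 - y| ≤ |θ|) :
    |∑ i, w i * (Real.log (1 + a * W i) * Real.log (1 + b * W i))
      - (∑ i, w i * Real.log (1 + a * W i)) * (∑ i, w i * Real.log (1 + b * W i))
      - a * b * y| ≤ 16 * K ^ 4 * |θ| ^ 3 := by
  have hθ := abs_nonneg θ
  have haW := fun i => abs_mul_le_of_abs_le_one ha (hW i)
  have hbW := fun i => abs_mul_le_of_abs_le_one hb (hW i)
  have A := abs_weighted_sum_sub_le hw hw1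
    (f := fun i => Real.log (1 + a * W i) * Real.log (1 + b * W i))
    (g := fun i => (a * W i) * (b * W i)) (c := 6 * (K * |θ|) ^ 3) fun i => by
      have e : Real.log (1 + a * W i) * Real.log (1 + b * W i) - (a * W i) * (b * W i)
        = (Real.log (1 + a * W i) - a * W i) * Real.log (1 + b * W i)
          + (a * W i) * (Real.log (1 + b * W i) - b * W i) := by ring
      have l1 := (abs_log_one_add_sub_le ((haW i).trans hKθ)).trans
        (by gcongr; exact haW i : _ ≤ 2 * (K * |θ|) ^ 2)
      have l2 := (abs_log_one_add_sub_le ((hbW i).trans hKθ)).trans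
        (by gcongr; exact hbW i : _ ≤ 2 * (K * |θ|) ^ 2)
      have l3 := (abs_log_one_add_le ((hbW i).trans hKθ)).trans
        (by gcongr; exact hbW i : _ ≤ 2 * (K * |θ|))
      rw [e]
      refine (abs_add_le _ _).trans ?_
      rw [abs_mul, abs_mul]
      calc _ ≤ 2 * (K * |θ|) ^ 2 * (2 * (K * |θ|)) + K * |θ| * (2 * (K * |θ|) ^ 2) := by
            gcongr
            exact haW i
        _ = _ := by ring
  have e : ∑ i, w i * (a * W i * (b * W i)) = a * b * ∑ i, w i * W i ^ 2 := by
    rw [Finset.mul_sum]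
    exact Finset.sum_congr rfl fun i _ => by ring
  rw [e] at A
  have B : |a * b * (∑ i, w i * W i ^ 2 - y)| ≤ K * |θ| * (K * |θ|) * |θ| := by
    rw [abs_mul, abs_mul]
    gcongr
  have P : |(∑ i, w i * Real.log (1 + a * W i)) * (∑ i, w i * Real.log (1 + b * W i))|
      ≤ (3 * K ^ 2 * |θ| ^ 2) * (3 * K ^ 2 * |θ| ^ 2) := by
    rw [abs_mul]
    gcongr
    · exact abs_mean_log_le hw hw1 hW hK hKθ ha hx h1
    · exact abs_mean_log_le hw hw1 hW hK hKθ hb hx h1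
  have hθ1 : |θ| ≤ 1 := by nlinarith
  have hK2 : K ^ 2 * |θ| ^ 3 ≤ K ^ 4 * |θ| ^ 3 := by
    gcongr
    norm_num
  have hK3 : K ^ 3 * |θ| ^ 3 ≤ K ^ 4 * |θ| ^ 3 := by
    gcongr
    norm_num
  have hK4 : K ^ 4 * |θ| ^ 4 ≤ K ^ 4 * |θ| ^ 3 := by
    gcongr ?_ * ?_
    exact pow_le_pow_of_le_one hθ hθ1 (by norm_num)
  have hp : 0 ≤ K ^ 4 * |θ| ^ 3 := by positivity
  rw [abs_le] at A B P ⊢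
  constructor <;> nlinarith

end Moments

section Tree

variable {d n : ℕ}

/-- The restriction of a configuration to the subtree of the `j`-th child of the root. -/
def subtree (σ : Conf d (n + 1)) (j : Fin d) : Conf d n :=
  fun k w => σ k.succ (Fin.cons j w)

/-- A configuration is a root spin together with a configuration on each child's subtree. -/
def confEquiv (d n : ℕ) : Conf d (n + 1) ≃ Fin 2 × (Fin d → Conf d n) where
  toFun σ := (root σ, subtree σ)
  invFun r := Fin.cases (fun _ => r.1) 
    (fun k (w : Fin ((k : ℕ) + 1) → Fin d) => r.2 (w 0) k (Fin.tail w))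
  left_inv σ := by
    funext k
    refine Fin.cases ?_ (fun k => ?_) k
    · funext v
      exact congrArg (σ 0) (Subsingleton.elim (α := Fin 0 → Fin d) _ _)
    · funext v
      exact congrArg (σ k.succ) (Fin.cons_self_tail v)
  right_inv r := rfl

/-- The probability of a configuration given its root spin. -/
noncomputable def edgeWeight (d : ℕ) (θ Δ : ℝ) (n : ℕ) (σ : Conf d n) : ℝ :=
  ∏ k : Fin n, ∏ v : Vert d (k + 1),
    Mmat θ Δ (σ k.castSucc (v ∘ Fin.castSucc)) (σ k.succ v)

lemma prod_vert_succ {m : ℕ} (f : Vert d (m + 1) → ℝ) :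
    ∏ v, f v = ∏ j : Fin d, ∏ w : Vert d m, f (Fin.cons j w) := by
  rw [← Fintype.prod_prod_type']
  exact (Fintype.prod_equiv (Fin.consEquiv fun _ => Fin d) _ _ fun _ => rfl).symm

lemma cons_comp_castSucc {m : ℕ} (j : Fin d) (w : Vert d (m + 1)) :
    (Fin.cons j w : Vert d (m + 2)) ∘ Fin.castSucc
      = (Fin.cons j (w ∘ Fin.castSucc) : Vert d (m + 1)) := by
  funext i
  refine Fin.cases rfl (fun i => ?_) i
  rfl

lemma edgeWeight_succ (θ Δ : ℝ) (σ : Conf d (n + 1)) :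
    edgeWeight d θ Δ (n + 1) σ = ∏ j : Fin d,
      (Mmat θ Δ (root σ) (root (subtree σ j)) * edgeWeight d θ Δ n (subtree σ j)) := by
  rw [edgeWeight, Fin.prod_univ_succ, Finset.prod_mul_distrib]
  congr 1
  · refine (prod_vert_succ (m := 0) _).trans (Finset.prod_congr rfl fun j _ => ?_)
    rw [Fintype.prod_subsingleton _ (fun i : Fin 0 => i.elim0)]
    congr 1
    exact congrArg (σ 0) (Subsingleton.elim (α := Fin 0 → Fin d) _ _)
  · simp only [edgeWeight]
    rw [Finset.prod_comm]
    refine Finset.prod_congr rfl fun k _ => ?_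
    refine (prod_vert_succ (m := (k : ℕ) + 1) _).trans (Finset.prod_congr rfl fun j _ => ?_)
    refine Finset.prod_congr rfl fun w _ => ?_
    congr 1
    exact congrArg (σ k.succ.castSucc) (cons_comp_castSucc j w)

/-- Given the root spin, the subtrees of the children are independent. -/
lemma sum_edgeWeight_succ (θ Δ : ℝ) (i : Fin 2) (h : Fin d → Conf d n → ℝ) :
    ∑ σ : Conf d (n + 1), (if root σ = i then
      edgeWeight d θ Δ (n + 1) σ * ∏ j, h j (subtree σ j) else 0)
    = ∏ j, ∑ τ : Conf d n, Mmat θ Δ i (root τ) * edgeWeight d θ Δ n τ * h j τ := by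
  rw [Fintype.prod_sum]
  rw [Fintype.sum_equiv (confEquiv d n) _ (fun r : Fin 2 × (Fin d → Conf d n) => if r.1 = i then
    ∏ j, (Mmat θ Δ i (root (r.2 j)) * edgeWeight d θ Δ n (r.2 j) * h j (r.2 j)) else 0) ?_]
  · rw [Fintype.sum_prod_type, Finset.sum_comm]
    exact Finset.sum_congr rfl fun τ _ => by simp
  · intro σ
    change _ = if root σ = i then ∏ j, (Mmat θ Δ i (root (subtree σ j)) *
      edgeWeight d θ Δ n (subtree σ j) * h j (subtree σ j)) else 0
    split_ifs with hi
    · rw [edgeWeight_succ, ← Finset.prod_mul_distrib, hi]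
    · rfl

lemma sum_eq_sum_root (f : Fin 2 → Conf d n → ℝ) :
    ∑ τ : Conf d n, f (root τ) τ = ∑ k, ∑ τ : Conf d n, if root τ = k then f k τ else 0 := by
  rw [Finset.sum_comm]
  exact Finset.sum_congr rfl fun τ _ => by simp

lemma sum_Mmat (θ Δ : ℝ) (i : Fin 2) : ∑ k, Mmat θ Δ i k = 1 := by
  fin_cases i <;> simp [Mmat, Fin.sum_univ_two] <;> ring

lemma sum_Mmat_mul_edgeWeight {θ Δ : ℝ}
    (h : ∀ k, ∑ σ : Conf d n, (if root σ = k then edgeWeight d θ Δ n σ else 0) = 1) (i : Fin 2) :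
    ∑ τ : Conf d n, Mmat θ Δ i (root τ) * edgeWeight d θ Δ n τ = 1 := by
  rw [sum_eq_sum_root fun k τ => Mmat θ Δ i k * edgeWeight d θ Δ n τ, ← sum_Mmat θ Δ i]
  refine Finset.sum_congr rfl fun k _ => ?_
  conv_rhs => rw [← mul_one (Mmat θ Δ i k), ← h k, Finset.mul_sum]
  exact Finset.sum_congr rfl fun τ _ => by split_ifs <;> simp

lemma sum_edgeWeight (d : ℕ) (θ Δ : ℝ) (n : ℕ) (i : Fin 2) :
    ∑ σ : Conf d n, (if root σ = i then edgeWeight d θ Δ n σ else 0) = 1 := by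
  induction n generalizing i with
  | zero =>
    let e : Conf d 0 ≃ Fin 2 :=
      { toFun := root
        invFun := fun r _ _ => r
        left_inv := fun σ => by
          funext k v
          obtain rfl : k = 0 := Subsingleton.elim (α := Fin 1) _ _
          exact congrArg (σ 0) (Subsingleton.elim (α := Fin 0 → Fin d) _ _)
        right_inv := fun r => rfl }
    rw [Fintype.sum_equiv e _ (fun r => if r = i then 1 else 0) fun σ => by
      change (if root σ = i then edgeWeight d θ Δ 0 σ else 0) = if root σ = i then 1 else 0
      simp [edgeWeight]]
    simp
  | succ n ih =>
    have h := sum_edgeWeight_succ (d := d) (n := n) θ Δ i (fun _ _ => 1)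
    simp only [Finset.prod_const_one, mul_one] at h
    rw [h]
    refine Finset.prod_eq_one fun j _ => ?_
    exact sum_Mmat_mul_edgeWeight ih i

/-- Expectation of a function of the level-`n` spins given the root spin. -/
noncomputable def expectRoot (d : ℕ) (θ Δ : ℝ) (n : ℕ) (i : Fin 2) (g : LConf d n → ℝ) : ℝ :=
  ∑ A : LConf d n, condLevel d θ Δ n i A * g A

lemma expectRoot_eq {θ Δ : ℝ} {i : Fin 2} (hi : pst θ Δ i ≠ 0) (g : LConf d n → ℝ) :
    expectRoot d θ Δ n i g
      = ∑ σ : Conf d n, if root σ = i then edgeWeight d θ Δ n σ * g (top σ) else 0 := by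
  simp only [expectRoot, condLevel, jointProb, Finset.sum_div, Finset.sum_mul]
  rw [Finset.sum_comm]
  refine Finset.sum_congr rfl fun σ _ => ?_
  rw [Finset.sum_eq_single (top σ)]
  · by_cases h : root σ = i
    · simp only [h, confProb, edgeWeight, and_self, if_true]
      field_simp
    · simp [h]
  · intro A _ hA
    simp [hA.symm]
  · simp

lemma sum_condLevel {θ Δ : ℝ} {i : Fin 2} (hi : pst θ Δ i ≠ 0) :
    ∑ A : LConf d n, condLevel d θ Δ n i A = 1 := by
  have h := expectRoot_eq (d := d) (n := n) hi (fun _ => 1)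
  simpa [expectRoot, sum_edgeWeight] using h

lemma expectRoot_one {θ Δ : ℝ} {i : Fin 2} (hi : pst θ Δ i ≠ 0) :
    expectRoot d θ Δ n i (fun _ => 1) = 1 := by
  simpa [expectRoot] using sum_condLevel (d := d) (n := n) hi

/-- The spins below a child of the root, given the root spin, are a mixture over the child's
spin. -/
lemma expectRoot_restrictChild {θ Δ : ℝ} (hp : ∀ i, pst θ Δ i ≠ 0) (i : Fin 2) (j : Fin d)
    (g : LConf d n → ℝ) :
    expectRoot d θ Δ (n + 1) i (fun A => g (restrictChild j A))
      = ∑ k, Mmat θ Δ i k * expectRoot d θ Δ n k g := by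
  have h := sum_edgeWeight_succ (d := d) (n := n) θ Δ i
    (fun j' τ => if j' = j then g (top τ) else 1)
  have hone : ∀ j' : Fin d, j' ≠ j → ∑ τ : Conf d n, Mmat θ Δ i (root τ) * edgeWeight d θ Δ n τ *
      (if j' = j then g (top τ) else 1) = 1 := by
    intro j' hj
    simp only [hj, if_false, mul_one]
    exact sum_Mmat_mul_edgeWeight (sum_edgeWeight d θ Δ n) i
  rw [Finset.prod_eq_single j (fun j' _ hj => hone j' hj) (by simp)] at h
  rw [expectRoot_eq (hp i)]
  refine Eq.trans (Finset.sum_congr rfl fun σ _ => ?_) (h.trans ?_)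
  · rw [Finset.prod_ite_eq' Finset.univ j]
    simp only [Finset.mem_univ, if_true]
    rfl
  · simp only [if_true]
    rw [sum_eq_sum_root fun k τ => Mmat θ Δ i k * edgeWeight d θ Δ n τ * g (top τ)]
    refine Finset.sum_congr rfl fun k _ => ?_
    rw [expectRoot_eq (hp k), Finset.mul_sum]
    exact Finset.sum_congr rfl fun τ _ => by split_ifs <;> ring

lemma jointProb_nonneg {θ Δ : ℝ} (hp : ∀ i, 0 ≤ pst θ Δ i) (hM : ∀ i j, 0 ≤ Mmat θ Δ i j)
    (i : Fin 2) (A : LConf d n) : 0 ≤ jointProb d θ Δ n i A := by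
  refine Finset.sum_nonneg fun σ _ => ?_
  split_ifs
  · exact mul_nonneg (hp _) (Finset.prod_nonneg fun k _ => Finset.prod_nonneg fun v _ => hM _ _)
  · exact le_rfl

lemma levelProb_eq (θ Δ : ℝ) (A : LConf d n) :
    levelProb d θ Δ n A = jointProb d θ Δ n 0 A + jointProb d θ Δ n 1 A := by
  simp only [levelProb, jointProb]
  rw [← Finset.sum_add_distrib]
  refine Finset.sum_congr rfl fun σ _ => ?_
  rcases (by omega : root σ = 0 ∨ root σ = 1) with h | h <;> simp [h]

end Tree

section Posterior

variable {d n : ℕ} {θ Δ : ℝ}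

lemma post_nonneg (hp : ∀ i, 0 ≤ pst θ Δ i) (hM : ∀ i j, 0 ≤ Mmat θ Δ i j) (A : LConf d n) :
    0 ≤ post d θ Δ n 0 A := by
  have h0 := jointProb_nonneg hp hM 0 A
  have h1 := jointProb_nonneg hp hM 1 A
  rw [post, levelProb_eq]
  positivity

lemma post_le_one (hp : ∀ i, 0 ≤ pst θ Δ i) (hM : ∀ i j, 0 ≤ Mmat θ Δ i j) (A : LConf d n) :
    post d θ Δ n 0 A ≤ 1 := by
  have h0 := jointProb_nonneg hp hM 0 A
  have h1 := jointProb_nonneg hp hM 1 A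
  rw [post, levelProb_eq]
  exact div_le_one_of_le₀ (by linarith) (by linarith)

lemma post_mul_levelProb (hp : ∀ i, 0 ≤ pst θ Δ i) (hM : ∀ i j, 0 ≤ Mmat θ Δ i j)
    (A : LConf d n) :
    post d θ Δ n 0 A * (jointProb d θ Δ n 0 A + jointProb d θ Δ n 1 A)
      = jointProb d θ Δ n 0 A := by
  have h0 := jointProb_nonneg hp hM 0 A
  have h1 := jointProb_nonneg hp hM 1 A
  rw [post, levelProb_eq]
  by_cases h : jointProb d θ Δ n 0 A + jointProb d θ Δ n 1 A = 0
  · rw [h, mul_zero]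
    linarith
  · exact div_mul_cancel₀ _ h

/-- Bayes' rule: averaging over the root spin, multiplying by the posterior of state `0` amounts
to restricting to root spin `0`. -/
lemma expectRoot_post_mul (hp : ∀ i, 0 < pst θ Δ i) (hM : ∀ i j, 0 ≤ Mmat θ Δ i j)
    (g : LConf d n → ℝ) :
    pst θ Δ 0 * expectRoot d θ Δ n 0 (fun A => post d θ Δ n 0 A * g A)
      + pst θ Δ 1 * expectRoot d θ Δ n 1 (fun A => post d θ Δ n 0 A * g A)
      = pst θ Δ 0 * expectRoot d θ Δ n 0 g := by
  simp only [expectRoot, Finset.mul_sum]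
  rw [← Finset.sum_add_distrib]
  refine Finset.sum_congr rfl fun A _ => ?_
  have h := post_mul_levelProb (fun i => (hp i).le) hM A
  have h0 : pst θ Δ 0 * condLevel d θ Δ n 0 A = jointProb d θ Δ n 0 A :=
    mul_div_cancel₀ _ (hp 0).ne'
  have h1 : pst θ Δ 1 * condLevel d θ Δ n 1 A = jointProb d θ Δ n 1 A :=
    mul_div_cancel₀ _ (hp 1).ne'
  linear_combination (post d θ Δ n 0 A * g A - g A) * h0 + (post d θ Δ n 0 A * g A) * h1 + g A * h

lemma condLevel_nonneg (hp : ∀ i, 0 ≤ pst θ Δ i) (hM : ∀ i j, 0 ≤ Mmat θ Δ i j)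
    (i : Fin 2) (A : LConf d n) : 0 ≤ condLevel d θ Δ n i A :=
  div_nonneg (jointProb_nonneg hp hM i A) (hp i)

lemma expectRoot_sub_const {i : Fin 2} (hi : pst θ Δ i ≠ 0) (g : LConf d n → ℝ) (c : ℝ) :
    expectRoot d θ Δ n i (fun A => g A - c) = expectRoot d θ Δ n i g - c := by
  simp only [expectRoot, mul_sub, Finset.sum_sub_distrib]
  rw [← Finset.sum_mul, sum_condLevel hi, one_mul]

lemma expectRoot_sub_const_sq {i : Fin 2} (hi : pst θ Δ i ≠ 0) (g : LConf d n → ℝ) (c : ℝ) :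
    expectRoot d θ Δ n i (fun A => (g A - c) ^ 2)
      = expectRoot d θ Δ n i (fun A => g A * g A) - 2 * c * expectRoot d θ Δ n i g + c ^ 2 := by
  have h : c ^ 2 = ∑ A : LConf d n, condLevel d θ Δ n i A * c ^ 2 := by
    rw [← Finset.sum_mul, sum_condLevel hi, one_mul]
  rw [h]
  simp only [expectRoot, Finset.mul_sum]
  rw [← Finset.sum_sub_distrib, ← Finset.sum_add_distrib]
  exact Finset.sum_congr rfl fun A _ => by ring

lemma abs_post_sub_le (hp : ∀ i, 0 ≤ pst θ Δ i) (hM : ∀ i j, 0 ≤ Mmat θ Δ i j)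
    (hp1 : pst θ Δ 0 ≤ 1) (A : LConf d n) : |post d θ Δ n 0 A - pst θ Δ 0| ≤ 1 := by
  have h0 := post_nonneg hp hM A
  have h1 := post_le_one hp hM A
  have := hp 0
  rw [abs_le]
  constructor <;> linarith

lemma pst_Dlt {π1 π2 : ℝ} (hsum : π1 + π2 = 1) (hθ : θ < 1) :
    pst θ (Dlt θ π1 π2) 0 = π1 ∧ pst θ (Dlt θ π1 π2) 1 = π2 := by
  have h : 1 - θ ≠ 0 := by linarith
  obtain rfl : π2 = 1 - π1 := by linarith
  constructor
  · simp only [pst, Dlt, if_true]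
    field_simp
    ring
  · simp only [pst, Dlt, one_ne_zero, if_false]
    field_simp
    ring

lemma Mmat_Dlt {π1 π2 : ℝ} (hsum : π1 + π2 = 1) :
    Mmat θ (Dlt θ π1 π2) 0 0 = π1 + θ * π2 ∧ Mmat θ (Dlt θ π1 π2) 0 1 = (1 - θ) * π2 := by
  constructor
  · simp only [Mmat, Dlt, if_true]
    linear_combination (-(1 + θ) / 2) * hsum
  · simp only [Mmat, Dlt, if_true, one_ne_zero, if_false]
    linear_combination (-(1 - θ) / 2) * hsum

lemma abs_xseq_le (hp : ∀ i, 0 < pst θ Δ i) (hM : ∀ i j, 0 ≤ Mmat θ Δ i j)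
    (hp1 : pst θ Δ 0 ≤ 1) : |xseq d θ Δ n| ≤ 1 := by
  rw [xseq, expect1, ← expectRoot, ← expectRoot_sub_const (hp 0).ne']
  exact abs_weighted_sum_le (condLevel_nonneg (fun i => (hp i).le) hM 0)
    (sum_condLevel (hp 0).ne') (abs_post_sub_le (fun i => (hp i).le) hM hp1)

variable {π1 π2 : ℝ}

/-- The mean of the posterior at a child of the root. -/
lemma mean_Yfun_sub (hsum : π1 + π2 = 1) (h1 : 0 < π1) (h2 : 0 < π2) (hθ : θ < 1)
    (hM : ∀ i j, 0 ≤ Mmat θ (Dlt θ π1 π2) i j) (j : Fin d) :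
    ∑ A, condLevel d θ (Dlt θ π1 π2) (n + 1) 0 A * (Yfun d θ (Dlt θ π1 π2) n j A - π1)
      = θ * xseq d θ (Dlt θ π1 π2) n := by
  obtain ⟨e0, e1⟩ := pst_Dlt hsum hθ
  have hp : ∀ i, 0 < pst θ (Dlt θ π1 π2) i := by
    rw [Fin.forall_fin_two, e0, e1]
    exact ⟨h1, h2⟩
  have hc := expectRoot_restrictChild (n := n) (fun i => (hp i).ne') 0 j
    (fun A => post d θ (Dlt θ π1 π2) n 0 A - π1)
  have hb := expectRoot_post_mul (d := d) (n := n) hp hM (fun _ => 1)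
  refine Eq.trans hc ?_
  rw [Fin.sum_univ_two, expectRoot_sub_const (hp 0).ne', expectRoot_sub_const (hp 1).ne',
    xseq, expect1, ← expectRoot, e0]
  simp only [mul_one, expectRoot_one (hp 0).ne', e0, e1] at hb
  obtain ⟨hM0, hM1⟩ := Mmat_Dlt (θ := θ) hsum
  rw [hM0, hM1]
  linear_combination (1 - θ) * hb + (θ * expectRoot d θ (Dlt θ π1 π2) n 0
    (fun A => post d θ (Dlt θ π1 π2) n 0 A) - π1) * hsum

/-- The second moment of the posterior at a child of the root. -/
lemma abs_mean_Yfun_sub_sq_sub_le (hsum : π1 + π2 = 1) (h1 : 0 < π1) (h2 : 0 < π2) (hθ : θ < 1)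
    (hM : ∀ i j, 0 ≤ Mmat θ (Dlt θ π1 π2) i j) (j : Fin d) :
    |∑ A, condLevel d θ (Dlt θ π1 π2) (n + 1) 0 A * (Yfun d θ (Dlt θ π1 π2) n j A - π1) ^ 2
      - π1 * xseq d θ (Dlt θ π1 π2) n| ≤ |θ| := by
  obtain ⟨e0, e1⟩ := pst_Dlt hsum hθ
  have hp : ∀ i, 0 < pst θ (Dlt θ π1 π2) i := by
    rw [Fin.forall_fin_two, e0, e1]
    exact ⟨h1, h2⟩
  have hc : ∑ A, condLevel d θ (Dlt θ π1 π2) (n + 1) 0 A * (Yfun d θ (Dlt θ π1 π2) n j A - π1) ^ 2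
      = _ := expectRoot_restrictChild (n := n) (fun i => (hp i).ne') 0 j
    (fun A => (post d θ (Dlt θ π1 π2) n 0 A - π1) ^ 2)
  have hz : ∀ i, 0 ≤ expectRoot d θ (Dlt θ π1 π2) n i
        (fun A => (post d θ (Dlt θ π1 π2) n 0 A - π1) ^ 2) ∧
      expectRoot d θ (Dlt θ π1 π2) n i
        (fun A => (post d θ (Dlt θ π1 π2) n 0 A - π1) ^ 2) ≤ 1 := by
    intro i
    refine ⟨Finset.sum_nonneg fun A _ =>
      mul_nonneg (condLevel_nonneg (fun i => (hp i).le) hM i A) (sq_nonneg _), ?_⟩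
    refine (le_abs_self _).trans (abs_weighted_sum_le
      (condLevel_nonneg (fun i => (hp i).le) hM i) (sum_condLevel (hp i).ne') fun A => ?_)
    have := abs_post_sub_le (fun i => (hp i).le) hM (by rw [e0]; linarith) A
    rw [e0] at this
    rw [abs_pow]
    exact pow_le_one₀ (abs_nonneg _) this
  obtain ⟨z0, z0'⟩ := hz 0
  obtain ⟨z1, z1'⟩ := hz 1
  have hb := expectRoot_post_mul (d := d) (n := n) hp hM (fun _ => 1)
  have hb2 := expectRoot_post_mul (d := d) (n := n) hp hM
    (fun A => post d θ (Dlt θ π1 π2) n 0 A)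
  simp only [mul_one, expectRoot_one (hp 0).ne', e0, e1] at hb hb2
  have s0 := expectRoot_sub_const_sq (hp 0).ne' (fun A => post d θ (Dlt θ π1 π2) n 0 A) π1
  have s1 := expectRoot_sub_const_sq (hp 1).ne' (fun A => post d θ (Dlt θ π1 π2) n 0 A) π1
  obtain ⟨hM0, hM1⟩ := Mmat_Dlt (θ := θ) hsum
  rw [hc, Fin.sum_univ_two, hM0, hM1, xseq, expect1, ← expectRoot, e0]
  set E0 := expectRoot d θ (Dlt θ π1 π2) n 0
    (fun A => (post d θ (Dlt θ π1 π2) n 0 A - π1) ^ 2)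
  set E1 := expectRoot d θ (Dlt θ π1 π2) n 1
    (fun A => (post d θ (Dlt θ π1 π2) n 0 A - π1) ^ 2)
  have key : (π1 + θ * π2) * E0 + (1 - θ) * π2 * E1
      - π1 * (expectRoot d θ (Dlt θ π1 π2) n 0 (fun A => post d θ (Dlt θ π1 π2) n 0 A) - π1)
      = θ * (π2 * (E0 - E1)) := by
    linear_combination π1 * s0 + π2 * s1 + hb2 - 2 * π1 * hb + π1 ^ 2 * hsum
  rw [key, abs_mul]
  refine mul_le_of_le_one_right (abs_nonneg θ) ?_
  rw [abs_mul, abs_of_pos h2]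
  exact mul_le_one₀ (by linarith) (abs_nonneg _) (abs_le.2 ⟨by linarith, by linarith⟩)

end Posterior

/-- Assuming `dθ² ≤ 1`, there are positive constants `C = C(π)` and
`D = D(π)` such that whenever `d > D`, for all `n` and all `1 ≤ j ≤ d` the means,
variances and covariance of `U_j, V_j` satisfy the stated `C·d^{−1/2}`-approximations. -/
theorem UV_moments (π1 π2 : ℝ) (hsum : π1 + π2 = 1) (hord : π2 ≤ π1) (hpi2 : 0 < π2) :
    ∃ C D : ℝ, 0 < C ∧ 0 < D ∧
      ∀ d : ℕ, D < (d : ℝ) → ∀ θ : ℝ, θ ≠ 0 →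
        (∀ i j, 0 < Mmat θ (Dlt θ π1 π2) i j) → (d : ℝ) * θ ^ 2 ≤ 1 →
        ∀ n : ℕ, ∀ j : Fin d,
          |(d : ℝ) * EU d θ (Dlt θ π1 π2) n j -
              (d : ℝ) * θ ^ 2 / (2 * π1) * xseq d θ (Dlt θ π1 π2) n| ≤ C / Real.sqrt d ∧
          |(d : ℝ) * EV d θ (Dlt θ π1 π2) n j +
              (1 + π2) / (2 * π2 ^ 2) * ((d : ℝ) * θ ^ 2) * xseq d θ (Dlt θ π1 π2) n| ≤
            C / Real.sqrt d ∧
          |(d : ℝ) * varU d θ (Dlt θ π1 π2) n j -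
              (d : ℝ) * θ ^ 2 / π1 * xseq d θ (Dlt θ π1 π2) n| ≤ C / Real.sqrt d ∧
          |(d : ℝ) * varV d θ (Dlt θ π1 π2) n j -
              π1 / π2 ^ 2 * ((d : ℝ) * θ ^ 2) * xseq d θ (Dlt θ π1 π2) n| ≤
            C / Real.sqrt d ∧
          |(d : ℝ) * covUV d θ (Dlt θ π1 π2) n j +
              (d : ℝ) * θ ^ 2 / π2 * xseq d θ (Dlt θ π1 π2) n| ≤ C / Real.sqrt d := by
  have hpi1 : 0 < π1 := by linarith
  set K : ℝ := 1 / π2 with hKdef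
  have hK : 1 ≤ K := by
    rw [hKdef, le_div_iff₀ hpi2]
    linarith
  refine ⟨16 * K ^ 4, 4 * K ^ 2, by positivity, by positivity, ?_⟩
  intro d hd θ _ hM hdθ n j
  have hd0 : (0 : ℝ) < d := lt_of_le_of_lt (by positivity) hd
  have hKθ : K * |θ| ≤ 1 / 2 := by
    refine abs_le_of_sq_le_sq' ?_ (by norm_num) |>.2
    rw [mul_pow, sq_abs]
    nlinarith [sq_nonneg θ]
  have hθ1 : θ < 1 := by nlinarith [le_abs_self θ, abs_nonneg θ]
  have hM' : ∀ i j, 0 ≤ Mmat θ (Dlt θ π1 π2) i j := fun i j => (hM i j).le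
  obtain ⟨e0, e1⟩ := pst_Dlt hsum hθ1
  have hp : ∀ i, 0 < pst θ (Dlt θ π1 π2) i := by
    rw [Fin.forall_fin_two, e0, e1]
    exact ⟨hpi1, hpi2⟩
  have hp1 : pst θ (Dlt θ π1 π2) 0 ≤ 1 := by rw [e0]; linarith
  have hw := condLevel_nonneg (d := d) (n := n + 1) (fun i => (hp i).le) hM' 0
  have hw1 := sum_condLevel (d := d) (n := n + 1) (hp 0).ne'
  have hW : ∀ A, |Yfun d θ (Dlt θ π1 π2) n j A - π1| ≤ 1 := fun A => by
    have := abs_post_sub_le (d := d) (n := n) (fun i => (hp i).le) hM' hp1 (restrictChild j A)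
    rwa [e0] at this
  have hx := abs_xseq_le (d := d) (n := n) hp hM' hp1
  have m1 := mean_Yfun_sub (d := d) (n := n) hsum hpi1 hpi2 hθ1 hM' j
  have m2 := abs_mean_Yfun_sub_sq_sub_le (d := d) (n := n) hsum hpi1 hpi2 hθ1 hM' j
  have ha : |θ / π1| ≤ K * |θ| := by
    rw [abs_div, abs_of_pos hpi1, hKdef, div_mul_eq_mul_div, one_mul]
    gcongr
  have hb : |-(θ / π2)| ≤ K * |θ| := by
    rw [abs_neg, abs_div, abs_of_pos hpi2, hKdef, div_mul_eq_mul_div, one_mul]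
  have hU : ∀ A, Ufun d θ (Dlt θ π1 π2) n j A
      = Real.log (1 + θ / π1 * (Yfun d θ (Dlt θ π1 π2) n j A - π1)) := fun A => by
    rw [Ufun, e0]
  have hV : ∀ A, Vfun d θ (Dlt θ π1 π2) n j A
      = Real.log (1 + -(θ / π2) * (Yfun d θ (Dlt θ π1 π2) n j A - π1)) := fun A => by
    rw [Vfun, e0, e1, neg_mul, ← sub_eq_add_neg]
  have hK34 : 3 * K ^ 3 * |θ| ^ 3 ≤ 16 * K ^ 4 * |θ| ^ 3 := by
    gcongr <;> norm_num
  have hscale : ∀ {s t : ℝ}, |s| ≤ 16 * K ^ 4 * |θ| ^ 3 → t = d * s →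
      |t| ≤ 16 * K ^ 4 / Real.sqrt d := by
    rintro s t hs rfl
    have hsq := Real.sqrt_pos.2 hd0
    have h1 : |θ| * Real.sqrt d ≤ 1 := by
      refine abs_le_of_sq_le_sq' ?_ (by norm_num) |>.2
      rw [mul_pow, sq_abs, Real.sq_sqrt hd0.le]
      linarith
    rw [abs_mul, abs_of_pos hd0, le_div_iff₀ hsq]
    calc d * |s| * Real.sqrt d ≤ d * (16 * K ^ 4 * |θ| ^ 3) * Real.sqrt d := by gcongr
      _ = 16 * K ^ 4 * ((d * θ ^ 2) * (|θ| * Real.sqrt d)) := by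
          rw [← sq_abs θ]
          ring
      _ ≤ 16 * K ^ 4 * (1 * 1) := by gcongr
      _ = 16 * K ^ 4 := by ring
  have hπ1 := hpi1.ne'
  have hπ2 := hpi2.ne'
  simp only [varU, varV, covUV, EU, EV, expect1, hU, hV, sq (Real.log _), sq (Finset.sum _ _)]
  refine ⟨hscale ((abs_mean_log_sub_le hw hw1 hW hK hKθ ha m1 m2).trans hK34) ?_,
    hscale ((abs_mean_log_sub_le hw hw1 hW hK hKθ hb m1 m2).trans hK34) ?_,
    hscale (abs_cov_log_sub_le hw hw1 hW hK hKθ ha ha hx m1 m2) ?_,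
    hscale (abs_cov_log_sub_le hw hw1 hW hK hKθ hb hb hx m1 m2) ?_,
    hscale (abs_cov_log_sub_le hw hw1 hW hK hKθ ha hb hx m1 m2) ?_⟩
  · field_simp
    ring
  · obtain rfl : π1 = 1 - π2 := by linarith
    field_simp
    ring
  · field_simp
  · field_simp
  · field_simp
    ring

end AsymIsing
end

section
/- If 6·π1·π2 > 1, then f(s) < s for every s with 0 < s ≤ π2. -/
open Finset Filter

namespace AsymIsing

section

open MeasureTheory ProbabilityTheory

/-- `tanh x < x` for `x > 0`, without division. -/
theorem sinh_lt_mul_cosh {x : ℝ} (hx : 0 < x) : Real.sinh x < x * Real.cosh x := by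
  have hd : ∀ y : ℝ, HasDerivAt (fun y => y * Real.cosh y - Real.sinh y) (y * Real.sinh y) y := by
    intro y
    refine (((hasDerivAt_id' y).mul (Real.hasDerivAt_cosh y)).sub
      (Real.hasDerivAt_sinh y)).congr_deriv ?_
    ring
  have hmono : StrictMonoOn (fun y => y * Real.cosh y - Real.sinh y) (Set.Ici 0) := by
    refine strictMonoOn_of_deriv_pos (convex_Ici 0)
      (fun y _ => (hd y).continuousAt.continuousWithinAt) fun y hy => ?_
    rw [interior_Ici] at hy
    rw [(hd y).deriv]
    exact mul_pos hy (Real.sinh_pos_iff.2 hy)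
  simpa using hmono (Set.mem_Ici.2 le_rfl) (Set.mem_Ici.2 hx.le) hx

/-- The hyperbolic Cusa–Huygens inequality, in half-angle form. -/
theorem sinh_mul_cosh_lt {x : ℝ} (hx : 0 < x) :
    Real.sinh x * Real.cosh x < x * (1 + 2 / 3 * Real.sinh x ^ 2) := by
  have hd : ∀ y : ℝ, HasDerivAt
      (fun y => y * (1 + 2 / 3 * Real.sinh y ^ 2) - Real.sinh y * Real.cosh y)
      (4 / 3 * Real.sinh y * (y * Real.cosh y - Real.sinh y)) y := by
    intro y
    refine (((hasDerivAt_id' y).mul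
      ((((Real.hasDerivAt_sinh y).pow 2).const_mul (2 / 3)).const_add 1)).sub
      ((Real.hasDerivAt_sinh y).mul (Real.hasDerivAt_cosh y))).congr_deriv ?_
    simp only [Pi.pow_apply]
    push_cast
    linear_combination -Real.cosh_sq y
  have hmono : StrictMonoOn
      (fun y => y * (1 + 2 / 3 * Real.sinh y ^ 2) - Real.sinh y * Real.cosh y) (Set.Ici 0) := by
    refine strictMonoOn_of_deriv_pos (convex_Ici 0)
      (fun y _ => (hd y).continuousAt.continuousWithinAt) fun y hy => ?_
    rw [interior_Ici] at hy
    rw [(hd y).deriv]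
    exact mul_pos (mul_pos (by norm_num) (Real.sinh_pos_iff.2 hy))
      (sub_pos.2 (sinh_lt_mul_cosh hy))
  simpa using hmono (Set.mem_Ici.2 le_rfl) (Set.mem_Ici.2 hx.le) hx

theorem sinh_sq_mul_cosh_lt {x : ℝ} (hx : x ≠ 0) :
    Real.sinh x ^ 2 * Real.cosh x < x * Real.sinh x * (1 + 2 / 3 * Real.sinh x ^ 2) := by
  have key : ∀ y : ℝ, 0 < y →
      Real.sinh y ^ 2 * Real.cosh y < y * Real.sinh y * (1 + 2 / 3 * Real.sinh y ^ 2) := by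
    intro y hy
    have := mul_lt_mul_of_pos_left (sinh_mul_cosh_lt hy) (Real.sinh_pos_iff.2 hy)
    nlinarith
  rcases hx.lt_or_gt with h | h
  · simpa using key (-x) (neg_pos.2 h)
  · exact key x h

/-- The centred posterior (up to the factor `p * q`) minus its linear majorant, as a function of
half the log-likelihood ratio. -/
noncomputable def postExcess (p q x : ℝ) : ℝ :=
  (Real.exp x - Real.exp (-x)) / (p * Real.exp x + q * Real.exp (-x)) - 4 * q * x

theorem exp_mul_postExcess_add_neg {p q x : ℝ} (hp : 0 < p) (hq : 0 < q) (hsum : p + q = 1)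
    (h6 : 1 < 6 * p * q) (hx : x ≠ 0) :
    Real.exp x * postExcess p q x + Real.exp (-x) * postExcess p q (-x) < 0 := by
  have hcusa := sinh_sq_mul_cosh_lt hx
  have hS : 0 < x * Real.sinh x := by
    rcases hx.lt_or_gt with h | h
    · exact mul_pos_of_neg_of_neg h (Real.sinh_neg_iff.2 h)
    · exact mul_pos h (Real.sinh_pos_iff.2 h)
  have hE := Real.exp_pos x
  have hF := Real.exp_pos (-x)
  have hEF : Real.exp x * Real.exp (-x) = 1 := by rw [← Real.exp_add]; simp
  have hs := Real.sinh_eq x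
  have hc := Real.cosh_eq x
  set E := Real.exp x
  set F := Real.exp (-x)
  set S := Real.sinh x
  set C := Real.cosh x
  have hEd : E = C + S := by rw [hs, hc]; ring
  have hFd : F = C - S := by rw [hs, hc]; ring
  have hCS : C ^ 2 = 1 + S ^ 2 := by rw [hEd, hFd] at hEF; linarith
  have hD1 : 0 < p * E + q * F := by positivity
  have hD2 : 0 < p * F + q * E := by positivity
  have hD : (p * E + q * F) * (p * F + q * E) = 1 + 4 * p * q * S ^ 2 := by
    obtain rfl : p = 1 - q := by linarith
    rw [hEd, hFd]
    linear_combination hCS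
  have hDpos : 0 < 1 + 4 * p * q * S ^ 2 := by positivity
  have hmain : E * postExcess p q x + F * postExcess p q (-x)
      = 8 * q * (S ^ 2 * C / (1 + 4 * p * q * S ^ 2) - x * S) := by
    have h1 : E * ((E - F) / (p * E + q * F)) + F * ((F - E) / (p * F + q * E))
        = 8 * q * (S ^ 2 * C / (1 + 4 * p * q * S ^ 2)) := by
      rw [← hD, hs, hc]
      field_simp
      ring
    simp only [postExcess, neg_neg]
    linear_combination h1 + 8 * q * x * hs
  rw [hmain]
  refine mul_neg_of_pos_of_neg (by positivity) (sub_neg.2 ((div_lt_iff₀ hDpos).2 ?_))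
  have : x * S * (1 + 2 / 3 * S ^ 2) ≤ x * S * (1 + 4 * p * q * S ^ 2) := by
    gcongr
    linarith
  linarith

theorem continuous_postExcess {p q : ℝ} (hp : 0 < p) (hq : 0 < q) :
    Continuous (postExcess p q) := by
  unfold postExcess
  refine (Continuous.div (by fun_prop) (by fun_prop) fun x => ?_).sub (by fun_prop)
  positivity

theorem abs_exp_sub_exp_div_le {p q : ℝ} (hp : 0 < p) (hq : 0 < q) (x : ℝ) :
    |(Real.exp x - Real.exp (-x)) / (p * Real.exp x + q * Real.exp (-x))| ≤ 1 / p + 1 / q := by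
  have hE := Real.exp_pos x
  have hF := Real.exp_pos (-x)
  have hD : 0 < p * Real.exp x + q * Real.exp (-x) := by positivity
  rw [abs_div, abs_of_pos hD, div_le_iff₀ hD]
  have h : (1 / p + 1 / q) * (p * Real.exp x + q * Real.exp (-x))
      = Real.exp x + Real.exp (-x) + (q / p * Real.exp (-x) + p / q * Real.exp x) := by
    field_simp
    ring
  rw [h]
  have : 0 < q / p * Real.exp (-x) + p / q * Real.exp x := by positivity
  exact abs_le.2 ⟨by linarith, by linarith⟩

theorem integrable_exp_sub_exp_div {p q : ℝ} (hp : 0 < p) (hq : 0 < q) (a : ℝ) :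
    Integrable (fun v => (Real.exp (a * v) - Real.exp (-(a * v))) /
      (p * Real.exp (a * v) + q * Real.exp (-(a * v)))) (gaussianReal a 1) := by
  refine Integrable.of_bound (C := 1 / p + 1 / q) ?_
    (Eventually.of_forall fun v => abs_exp_sub_exp_div_le hp hq (a * v))
  refine (Continuous.div (by fun_prop) (by fun_prop) fun x => ?_).aestronglyMeasurable
  positivity

theorem integrable_id_gaussianReal (a : ℝ) : Integrable (fun v : ℝ => v) (gaussianReal a 1) :=
  (memLp_id_gaussianReal 1).integrable le_rfl

theorem integral_postExcess_neg {p q a : ℝ} (hp : 0 < p) (hq : 0 < q) (hsum : p + q = 1)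
    (h6 : 1 < 6 * p * q) (ha : a ≠ 0) :
    ∫ v, postExcess p q (a * v) ∂(gaussianReal a 1) < 0 := by
  have hint : Integrable (fun v => postExcess p q (a * v)) (gaussianReal a 1) := by
    refine (integrable_exp_sub_exp_div hp hq a).sub ?_
    simpa only [mul_assoc] using (integrable_id_gaussianReal a).const_mul (4 * q * a)
  rw [integral_gaussianReal_eq_integral_smul one_ne_zero]
  simp only [smul_eq_mul]
  set H : ℝ → ℝ := fun v => gaussianPDFReal a 1 v * postExcess p q (a * v) with hH
  have hHint : Integrable H := by
    rw [gaussianReal_of_var_ne_zero _ one_ne_zero,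
      integrable_withDensity_iff_integrable_smul₀' (by fun_prop)
        (Eventually.of_forall fun _ => gaussianPDF_lt_top)] at hint
    simpa [hH] using hint
  have hsym : ∀ v, H v + H (-v) = gaussianPDFReal 0 1 v * Real.exp (-(a ^ 2 / 2)) *
      (Real.exp (a * v) * postExcess p q (a * v)
        + Real.exp (-(a * v)) * postExcess p q (-(a * v))) := by
    intro v
    have hpdf : ∀ u, gaussianPDFReal a 1 u
        = gaussianPDFReal 0 1 u * Real.exp (-(a ^ 2 / 2)) * Real.exp (a * u) := by
      intro u
      simp only [gaussianPDFReal, mul_assoc, ← Real.exp_add]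
      congr 2
      simp
      ring
    have hev : gaussianPDFReal 0 1 (-v) = gaussianPDFReal 0 1 v := by simp [gaussianPDFReal]
    simp only [hH, hpdf, hev, mul_neg]
    ring
  have hneg : ∀ v, v ≠ 0 → H v + H (-v) < 0 := by
    intro v hv
    rw [hsym]
    exact mul_neg_of_pos_of_neg (mul_pos (gaussianPDFReal_pos _ _ _ one_ne_zero) (Real.exp_pos _))
      (exp_mul_postExcess_add_neg hp hq hsum h6 (mul_ne_zero ha hv))
  have hnonneg : ∀ v, 0 ≤ -(H v + H (-v)) := by
    intro v
    rcases eq_or_ne v 0 with rfl | hv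
    · simp [hH, postExcess]
    · exact (neg_pos.2 (hneg v hv)).le
  have hadd : ∫ v, -(H v + H (-v)) = -(2 * ∫ v, H v) := by
    rw [integral_neg, integral_add hHint hHint.comp_neg, integral_neg_eq_self]
    ring
  have hpos : 0 < ∫ v, -(H v + H (-v)) := by
    rw [integral_pos_iff_support_of_nonneg hnonneg (hHint.add hHint.comp_neg).neg]
    have hsub : Set.Ioo (0 : ℝ) 1 ⊆ Function.support fun v => -(H v + H (-v)) := fun v hv =>
      (neg_pos.2 (hneg v hv.1.ne')).ne'
    exact lt_of_lt_of_le (by simp) (measure_mono hsub)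
  linarith

theorem gfun_eq_integral {p q s : ℝ} (hp : 0 < p) (hq : 0 < q) (hsum : p + q = 1) (hs : 0 < s)
    {a : ℝ} (ha : a = Real.sqrt s / (2 * Real.sqrt p * q)) :
    gfun p q s = p * q * ∫ v, (Real.exp (a * v) - Real.exp (-(a * v))) /
      (p * Real.exp (a * v) + q * Real.exp (-(a * v))) ∂(gaussianReal a 1) := by
  have hsp : 0 < Real.sqrt p := Real.sqrt_pos.2 hp
  have hmap : gaussianReal a 1 = (gaussianReal 0 1).map (· + a) := by
    rw [gaussianReal_map_add_const, zero_add]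
  have hint := integrable_exp_sub_exp_div hp hq a
  rw [hmap] at hint ⊢
  have hemb : MeasurableEmbedding (fun w : ℝ => w + a) := measurableEmbedding_addRight a
  rw [hemb.integrable_map_iff] at hint
  rw [hemb.integral_map, ← integral_const_mul]
  have hpt : ∀ w : ℝ,
      (p * Real.exp (s * (1 / (2 * p)) + Real.sqrt s * (w / Real.sqrt p))) /
        (p * Real.exp (s * (1 / (2 * p)) + Real.sqrt s * (w / Real.sqrt p)) +
          q * Real.exp (s * (-(1 + q) / (2 * q ^ 2)) +
            Real.sqrt s * (-(p / q) * (w / Real.sqrt p)))) =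
      p + p * q * ((Real.exp (a * (w + a)) - Real.exp (-(a * (w + a)))) /
        (p * Real.exp (a * (w + a)) + q * Real.exp (-(a * (w + a))))) := by
    intro w
    set A := s * (1 / (2 * p)) + Real.sqrt s * (w / Real.sqrt p) with hA
    set B := s * (-(1 + q) / (2 * q ^ 2)) + Real.sqrt s * (-(p / q) * (w / Real.sqrt p)) with hB
    set x := a * (w + a) with hx
    have ha2 : a * a = s / (4 * p * q ^ 2) := by
      rw [ha, div_mul_div_comm, Real.mul_self_sqrt hs.le]
      congr 1
      linear_combination 4 * q ^ 2 * Real.mul_self_sqrt hp.le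
    have hAB : A = B + 2 * x := by
      have h1 : a * w = Real.sqrt s * (w / Real.sqrt p) / (2 * q) := by
        rw [ha]; field_simp
      have h2 : x = Real.sqrt s * (w / Real.sqrt p) / (2 * q) + s / (4 * p * q ^ 2) := by
        rw [hx, mul_add, h1, ha2]
      rw [hA, hB, h2, show Real.sqrt s * (-(p / q) * (w / Real.sqrt p))
        = -(p / q) * (Real.sqrt s * (w / Real.sqrt p)) by ring]
      generalize Real.sqrt s * (w / Real.sqrt p) = W
      obtain rfl : p = 1 - q := by linarith
      field_simp
      ring
    have e1 : Real.exp A = Real.exp (B + x) * Real.exp x := by rw [← Real.exp_add, hAB]; ring_nf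
    have e2 : Real.exp B = Real.exp (B + x) * Real.exp (-x) := by rw [← Real.exp_add]; ring_nf
    rw [e1, e2]
    have h1 := Real.exp_pos x
    have h2 := Real.exp_pos (-x)
    have h3 := Real.exp_pos (B + x)
    generalize Real.exp x = E at *
    generalize Real.exp (-x) = F at *
    generalize Real.exp (B + x) = G at *
    have hD : 0 < p * E + q * F := by positivity
    rw [show p * (G * E) / (p * (G * E) + q * (G * F)) = p * E / (p * E + q * F) by
      rw [show p * (G * E) + q * (G * F) = G * (p * E + q * F) by ring,
        show p * (G * E) = G * (p * E) by ring, mul_div_mul_left _ _ h3.ne']]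
    field_simp
    linear_combination (-E) * hsum
  unfold gfun
  simp only [hpt]
  rw [integral_add (integrable_const p) (by exact hint.const_mul (p * q))]
  simp

end

/-- If `6π₁π₂ > 1`, then `f(s) < s` for every `0 < s ≤ π₂`. -/
theorem gfun_lt_id (π1 π2 : ℝ) (hpi1 : 0 < π1) (hpi2 : 0 < π2) (hsum : π1 + π2 = 1)
    (hord : π2 ≤ π1) (h6 : 1 < 6 * π1 * π2) :
    ∀ s : ℝ, 0 < s → s ≤ π2 → gfun π1 π2 s < s := by
  intro s hs _
  obtain ⟨a, ha⟩ : ∃ a, a = Real.sqrt s / (2 * Real.sqrt π1 * π2) := ⟨_, rfl⟩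
  have hapos : 0 < a := by rw [ha]; positivity
  have hneg := integral_postExcess_neg hpi1 hpi2 hsum h6 hapos.ne'
  simp only [postExcess] at hneg
  rw [MeasureTheory.integral_sub (integrable_exp_sub_exp_div hpi1 hpi2 a)
    (((integrable_id_gaussianReal a).const_mul a).const_mul (4 * π2)),
    MeasureTheory.integral_const_mul, MeasureTheory.integral_const_mul,
    ProbabilityTheory.integral_id_gaussianReal, sub_neg] at hneg
  have hs' : s = π1 * π2 * (4 * π2 * (a * a)) := by
    have h2 : a * (2 * Real.sqrt π1 * π2) = Real.sqrt s := by
      rw [ha]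
      field_simp
    calc s = (a * (2 * Real.sqrt π1 * π2)) ^ 2 := by rw [h2, Real.sq_sqrt hs.le]
      _ = a * a * (4 * π2 ^ 2) * Real.sqrt π1 ^ 2 := by ring
      _ = π1 * π2 * (4 * π2 * (a * a)) := by rw [Real.sq_sqrt hpi1.le]; ring
  rw [gfun_eq_integral hpi1 hpi2 hsum hs ha]
  conv_rhs => rw [hs']
  exact mul_lt_mul_of_pos_left hneg (mul_pos hpi1 hpi2)

end AsymIsing
end
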